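/- Let r(n) count triples (x,y,z) ∈ ℤ³ with x²+y²+z²=n and r'(n) those with (x,y,z) ≡ (1,0,0) (mod 4). If n = k² with k an odd positive integer, then 12·r'(n) = r(n) + 6·(−1)^{(k−1)/2}·k. -/

import Mathlib

/-- Number of triples `(x,y,z) ∈ ℤ³` with `x²+y²+z² = n`. -/
noncomputable def r (n : ℕ) : ℕ :=
  Set.ncard {t : ℤ × ℤ × ℤ | t.1 ^ 2 + t.2.1 ^ 2 + t.2.2 ^ 2 = (n : ℤ)}

/-- Number of such triples with `(x,y,z) ≡ (1,0,0) (mod 4)`. -/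
noncomputable def r' (n : ℕ) : ℕ :=
  Set.ncard {t : ℤ × ℤ × ℤ | t.1 ^ 2 + t.2.1 ^ 2 + t.2.2 ^ 2 = (n : ℤ) ∧
    t.1 % 4 = 1 ∧ t.2.1 % 4 = 0 ∧ t.2.2 % 4 = 0}

namespace Stmt12

/-- the sign `(-1)^n` for integer `n` -/
def sg (n : ℤ) : ℤ := if n % 2 = 0 then 1 else -1

lemma sg_mul_self (n : ℤ) : sg n * sg n = 1 := by
  unfold sg; split_ifs <;> norm_num

lemma sg_add (a b : ℤ) : sg (a + b) = sg a * sg b := by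
  unfold sg; split_ifs <;> omega

lemma sg_cases (n : ℤ) : (sg n = 1 ∧ n % 2 = 0) ∨ (sg n = -1 ∧ n % 2 = 1) := by
  unfold sg; split_ifs <;> simp <;> omega

/-- the integers of absolute value at most `n` -/
noncomputable def I (n : ℕ) : Finset ℤ := Finset.Icc (-(n : ℤ)) n

lemma mem_I {n : ℕ} {x : ℤ} (h : x ^ 2 ≤ n) : x ∈ I n := by
  simp only [I, Finset.mem_Icc]
  constructor <;> nlinarith

/-- solutions of `x² + 8u² + 8v² = n`, `x ≡ 1 mod 4` -/
noncomputable def S (n : ℕ) : Finset (ℤ × ℤ × ℤ) :=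
  (I n ×ˢ I n ×ˢ I n).filter
    fun t => t.1 % 4 = 1 ∧ t.1 ^ 2 + 8 * t.2.1 ^ 2 + 8 * t.2.2 ^ 2 = (n : ℤ)

lemma mem_S {n : ℕ} {t : ℤ × ℤ × ℤ} :
    t ∈ S n ↔ t.1 % 4 = 1 ∧ t.1 ^ 2 + 8 * t.2.1 ^ 2 + 8 * t.2.2 ^ 2 = (n : ℤ) := by
  simp only [S, Finset.mem_filter, Finset.mem_product, and_iff_right_iff_imp]
  rintro ⟨-, h⟩
  refine ⟨mem_I ?_, mem_I ?_, mem_I ?_⟩ <;>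
    nlinarith [sq_nonneg t.1, sq_nonneg t.2.1, sq_nonneg t.2.2]

/-- solutions of `y² = n`, `y ≡ 1 mod 4` -/
noncomputable def T (n : ℕ) : Finset ℤ := (I n).filter fun y => y % 4 = 1 ∧ y ^ 2 = (n : ℤ)

lemma mem_T {n : ℕ} {y : ℤ} : y ∈ T n ↔ y % 4 = 1 ∧ y ^ 2 = (n : ℤ) := by
  simp only [T, Finset.mem_filter, and_iff_right_iff_imp]
  rintro ⟨-, h⟩
  exact mem_I h.le

/-- solutions of `x² + y² + 8u² + 8v² = n`, `x ≡ y ≡ 1 mod 4` -/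
noncomputable def Q (n : ℕ) : Finset (ℤ × ℤ × ℤ × ℤ) :=
  (I n ×ˢ I n ×ˢ I n ×ˢ I n).filter
    fun t => t.1 % 4 = 1 ∧ t.2.1 % 4 = 1 ∧
      t.1 ^ 2 + t.2.1 ^ 2 + 8 * t.2.2.1 ^ 2 + 8 * t.2.2.2 ^ 2 = (n : ℤ)

lemma mem_Q {n : ℕ} {t : ℤ × ℤ × ℤ × ℤ} :
    t ∈ Q n ↔ t.1 % 4 = 1 ∧ t.2.1 % 4 = 1 ∧
      t.1 ^ 2 + t.2.1 ^ 2 + 8 * t.2.2.1 ^ 2 + 8 * t.2.2.2 ^ 2 = (n : ℤ) := by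
  simp only [Q, Finset.mem_filter, Finset.mem_product, and_iff_right_iff_imp]
  rintro ⟨-, -, h⟩
  refine ⟨mem_I ?_, mem_I ?_, mem_I ?_, mem_I ?_⟩ <;>
    nlinarith [sq_nonneg t.1, sq_nonneg t.2.1, sq_nonneg t.2.2.1, sq_nonneg t.2.2.2]

/-- solutions of `2s² + 8w² + 8u² + 8v² = n`, `s ≡ 1 mod 4` -/
noncomputable def R (n : ℕ) : Finset (ℤ × ℤ × ℤ × ℤ) :=
  (I n ×ˢ I n ×ˢ I n ×ˢ I n).filter
    fun t => t.1 % 4 = 1 ∧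
      2 * t.1 ^ 2 + 8 * t.2.1 ^ 2 + 8 * t.2.2.1 ^ 2 + 8 * t.2.2.2 ^ 2 = (n : ℤ)

lemma mem_R {n : ℕ} {t : ℤ × ℤ × ℤ × ℤ} :
    t ∈ R n ↔ t.1 % 4 = 1 ∧
      2 * t.1 ^ 2 + 8 * t.2.1 ^ 2 + 8 * t.2.2.1 ^ 2 + 8 * t.2.2.2 ^ 2 = (n : ℤ) := by
  simp only [R, Finset.mem_filter, Finset.mem_product, and_iff_right_iff_imp]
  rintro ⟨-, h⟩
  refine ⟨mem_I ?_, mem_I ?_, mem_I ?_, mem_I ?_⟩ <;>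
    nlinarith [sq_nonneg t.1, sq_nonneg t.2.1, sq_nonneg t.2.2.1, sq_nonneg t.2.2.2]

noncomputable def f (n : ℕ) : ℤ := ∑ t ∈ S n, sg (t.2.1 + t.2.2)
noncomputable def g (n : ℕ) : ℤ := ∑ y ∈ T n, y

/-- the weight on `R` -/
noncomputable def W (t : ℤ × ℤ × ℤ × ℤ) : ℤ := t.1 * (sg t.2.1 * sg t.2.2.1 * sg t.2.2.2)

lemma R_u (n : ℕ) : ∑ t ∈ R n, W t * t.2.2.1 ^ 2 = ∑ t ∈ R n, W t * t.2.1 ^ 2 := by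
  refine Finset.sum_nbij' (fun t => (t.1, t.2.2.1, t.2.1, t.2.2.2))
    (fun t => (t.1, t.2.2.1, t.2.1, t.2.2.2)) ?_ ?_ ?_ ?_ ?_
  · intro t; simp only [mem_R]; rintro ⟨h1, h2⟩; exact ⟨h1, by linarith⟩
  · intro t; simp only [mem_R]; rintro ⟨h1, h2⟩; exact ⟨h1, by linarith⟩
  · intro t _; rfl
  · intro t _; rfl
  · intro t _; simp only [W]; ring

lemma R_v (n : ℕ) : ∑ t ∈ R n, W t * t.2.2.2 ^ 2 = ∑ t ∈ R n, W t * t.2.1 ^ 2 := by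
  refine Finset.sum_nbij' (fun t => (t.1, t.2.2.2, t.2.2.1, t.2.1))
    (fun t => (t.1, t.2.2.2, t.2.2.1, t.2.1)) ?_ ?_ ?_ ?_ ?_
  · intro t; simp only [mem_R]; rintro ⟨h1, h2⟩; exact ⟨h1, by linarith⟩
  · intro t; simp only [mem_R]; rintro ⟨h1, h2⟩; exact ⟨h1, by linarith⟩
  · intro t _; rfl
  · intro t _; rfl
  · intro t _; simp only [W]; ring

lemma R_zero (n : ℕ) :
    ∑ t ∈ R n, 16 * (W t * t.2.2.1 ^ 2 + W t * t.2.2.2 ^ 2 - 2 * (W t * t.2.1 ^ 2)) = 0 := by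
  rw [← Finset.mul_sum, Finset.sum_sub_distrib, Finset.sum_add_distrib, ← Finset.mul_sum, R_u, R_v]
  ring

lemma Q_eq_R (n : ℕ) :
    ∑ t ∈ Q n, sg (t.2.2.1 + t.2.2.2) *
      ((t.1 + t.2.1) * (8 * t.2.2.1 ^ 2 + 8 * t.2.2.2 ^ 2 - (t.1 - t.2.1) ^ 2)) = 0 := by
  rw [← R_zero n]
  refine Finset.sum_nbij'
    (fun t => (sg ((t.1 - t.2.1) / 4) * ((t.1 + t.2.1) / 2), (t.1 - t.2.1) / 4, t.2.2.1, t.2.2.2))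
    (fun t => (sg t.2.1 * t.1 + 2 * t.2.1, sg t.2.1 * t.1 - 2 * t.2.1, t.2.2.1, t.2.2.2))
    ?_ ?_ ?_ ?_ ?_
  · rintro ⟨x, y, u, v⟩
    simp only [mem_R, mem_Q]
    rintro ⟨h1, h2, h3⟩
    obtain ⟨w, hw⟩ : ∃ w, w = (x - y) / 4 := ⟨_, rfl⟩
    obtain ⟨s, hs⟩ : ∃ s, s = (x + y) / 2 := ⟨_, rfl⟩
    rw [← hw, ← hs]
    have hx : x = s + 2 * w := by omega
    have hy : y = s - 2 * w := by omega
    refine ⟨?_, ?_⟩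
    · rcases sg_cases w with ⟨h, h'⟩ | ⟨h, h'⟩ <;> rw [h] <;> omega
    · subst hx; subst hy; linear_combination h3 + 2 * s ^ 2 * sg_mul_self w
  · rintro ⟨s, w, u, v⟩
    simp only [mem_R, mem_Q]
    rintro ⟨h1, h3⟩
    refine ⟨?_, ?_, ?_⟩
    · rcases sg_cases w with ⟨h, h'⟩ | ⟨h, h'⟩ <;> rw [h] <;> omega
    · rcases sg_cases w with ⟨h, h'⟩ | ⟨h, h'⟩ <;> rw [h] <;> omega
    · linear_combination h3 + 2 * s ^ 2 * sg_mul_self w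
  · rintro ⟨x, y, u, v⟩
    simp only [mem_Q, Prod.mk.injEq, and_true]
    rintro ⟨h1, h2, h3⟩
    rw [← mul_assoc, sg_mul_self]
    omega
  · rintro ⟨s, w, u, v⟩ _
    simp only [Prod.mk.injEq, and_true]
    have e1 : (sg w * s + 2 * w - (sg w * s - 2 * w)) / 4 = w := by omega
    have e2 : (sg w * s + 2 * w + (sg w * s - 2 * w)) / 2 = sg w * s := by omega
    rw [e1, e2, ← mul_assoc, sg_mul_self]
    simp
  · rintro ⟨x, y, u, v⟩
    simp only [mem_Q, W]
    rintro ⟨h1, h2, h3⟩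
    obtain ⟨w, hw⟩ : ∃ w, w = (x - y) / 4 := ⟨_, rfl⟩
    obtain ⟨s, hs⟩ : ∃ s, s = (x + y) / 2 := ⟨_, rfl⟩
    rw [← hw, ← hs]
    have hx : x = s + 2 * w := by omega
    have hy : y = s - 2 * w := by omega
    subst hx; subst hy
    rw [sg_add]
    linear_combination
      (-(16 * s * sg u * sg v * (u ^ 2 + v ^ 2 - 2 * w ^ 2))) * sg_mul_self w

lemma Q_swap (n : ℕ) :
    ∑ t ∈ Q n, sg (t.2.2.1 + t.2.2.2) *
      (t.1 * (t.2.1 ^ 2 + 8 * t.2.2.1 ^ 2 + 8 * t.2.2.2 ^ 2 - t.1 ^ 2)) =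
    ∑ t ∈ Q n, sg (t.2.2.1 + t.2.2.2) *
      (t.2.1 * (t.1 ^ 2 + 8 * t.2.2.1 ^ 2 + 8 * t.2.2.2 ^ 2 - t.2.1 ^ 2)) := by
  refine Finset.sum_nbij' (fun t => (t.2.1, t.1, t.2.2.1, t.2.2.2))
    (fun t => (t.2.1, t.1, t.2.2.1, t.2.2.2)) ?_ ?_ ?_ ?_ ?_
  · intro t; simp only [mem_Q]; rintro ⟨h1, h2, h3⟩; exact ⟨h2, h1, by linarith⟩
  · intro t; simp only [mem_Q]; rintro ⟨h1, h2, h3⟩; exact ⟨h2, h1, by linarith⟩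
  · intro t _; rfl
  · intro t _; rfl
  · intro t _; rfl

lemma Q_zero (n : ℕ) :
    ∑ t ∈ Q n, sg (t.2.2.1 + t.2.2.2) *
      (t.2.1 * (t.1 ^ 2 + 8 * t.2.2.1 ^ 2 + 8 * t.2.2.2 ^ 2 - t.2.1 ^ 2)) = 0 := by
  have h := Q_eq_R n
  have h2 := Q_swap n
  have : ∑ t ∈ Q n, sg (t.2.2.1 + t.2.2.2) *
      ((t.1 + t.2.1) * (8 * t.2.2.1 ^ 2 + 8 * t.2.2.2 ^ 2 - (t.1 - t.2.1) ^ 2)) =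
      ∑ t ∈ Q n, sg (t.2.2.1 + t.2.2.2) *
      (t.1 * (t.2.1 ^ 2 + 8 * t.2.2.1 ^ 2 + 8 * t.2.2.2 ^ 2 - t.1 ^ 2)) +
      ∑ t ∈ Q n, sg (t.2.2.1 + t.2.2.2) *
      (t.2.1 * (t.1 ^ 2 + 8 * t.2.2.1 ^ 2 + 8 * t.2.2.2 ^ 2 - t.2.1 ^ 2)) := by
    rw [← Finset.sum_add_distrib]
    refine Finset.sum_congr rfl fun t _ => ?_
    ring
  omega

lemma conv_zero (n : ℕ) :
    ∑ p ∈ Finset.HasAntidiagonal.antidiagonal n, ((p.1 : ℤ) - p.2) * (f p.1 * g p.2) = 0 := by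
  rw [← Q_zero n]
  have hm : ∀ t ∈ Q n, ((t.1 ^ 2 + 8 * t.2.2.1 ^ 2 + 8 * t.2.2.2 ^ 2).toNat, (t.2.1 ^ 2).toNat) ∈
      Finset.HasAntidiagonal.antidiagonal n := by
    intro t ht
    rw [mem_Q] at ht
    rw [Finset.HasAntidiagonal.mem_antidiagonal]
    zify
    rw [Int.toNat_of_nonneg (by positivity), Int.toNat_of_nonneg (by positivity)]
    linarith [ht.2.2]
  rw [← Finset.sum_fiberwise_of_maps_to hm]
  refine Finset.sum_congr rfl ?_
  rintro ⟨a, b⟩ hab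
  rw [Finset.HasAntidiagonal.mem_antidiagonal] at hab
  simp only at hab ⊢
  rw [f, g, Finset.sum_mul_sum, ← Finset.sum_product', Finset.mul_sum]
  refine Finset.sum_nbij' (fun t => (t.1.1, t.2, t.1.2.1, t.1.2.2))
    (fun t => ((t.1, t.2.2.1, t.2.2.2), t.2.1)) ?_ ?_ ?_ ?_ ?_
  · intro t
    simp only [Finset.mem_product, mem_S, mem_T, Finset.mem_filter, mem_Q, Prod.mk.injEq]
    rintro ⟨⟨h1, h2⟩, h3, h4⟩
    refine ⟨⟨h1, h3, ?_⟩, ?_, ?_⟩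
    · rw [← hab]; push_cast; linarith
    · rw [h2]; simp
    · rw [h4]; simp
  · intro t
    simp only [Finset.mem_product, mem_S, mem_T, Finset.mem_filter, mem_Q, Prod.mk.injEq]
    rintro ⟨⟨h1, h2, h3⟩, h4, h5⟩
    refine ⟨⟨h1, ?_⟩, h2, ?_⟩
    · rw [← h4, Int.toNat_of_nonneg (by positivity)]
    · rw [← h5, Int.toNat_of_nonneg (by positivity)]
  · intro t _; rfl
  · intro t _; rfl
  · intro t
    simp only [Finset.mem_product, mem_S, mem_T]
    rintro ⟨⟨h1, h2⟩, h3, h4⟩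
    rw [h2, h4]; ring

lemma f_zero : f 0 = 0 := by
  apply Finset.sum_eq_zero
  intro t ht
  rw [mem_S] at ht
  obtain ⟨h1, h2⟩ := ht
  have : t.1 = 0 := by
    push_cast at h2
    have : t.1 ^ 2 = 0 := by nlinarith [sq_nonneg t.1, sq_nonneg t.2.1, sq_nonneg t.2.2]
    exact pow_eq_zero_iff (two_ne_zero) |>.1 this
  omega

lemma g_zero : g 0 = 0 := by
  apply Finset.sum_eq_zero
  intro y hy
  rw [mem_T] at hy
  exact pow_eq_zero_iff (two_ne_zero) |>.1 (by simpa using hy.2)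

lemma f_one : f 1 = 1 := by
  have h : S 1 = {(1, 0, 0)} := by
    ext ⟨x, u, v⟩
    simp only [mem_S, Finset.mem_singleton, Prod.mk.injEq]
    constructor
    · rintro ⟨h1, h2⟩
      push_cast at h2
      have hu : u = 0 := by
        by_contra h
        have : 0 < u ^ 2 := by positivity
        nlinarith [sq_nonneg x, sq_nonneg v]
      have hv : v = 0 := by
        by_contra h
        have : 0 < v ^ 2 := by positivity
        nlinarith [sq_nonneg x, sq_nonneg u]
      subst hu; subst hv
      have : x = 1 ∨ x = -1 := by
        have h3 : x ^ 2 = 1 := by linarith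
        simpa using h3
      omega
    · rintro ⟨rfl, rfl, rfl⟩
      norm_num
  rw [f, h, Finset.sum_singleton]
  simp [sg]

lemma g_sq (k : ℕ) (hodd : Odd k) : g (k ^ 2) = (-1) ^ ((k - 1) / 2) * k := by
  obtain ⟨m, rfl⟩ := hodd
  have e : (2 * m + 1 - 1) / 2 = m := by omega
  rw [e]
  have hp : ((-1 : ℤ) ^ m = 1 ∧ m % 2 = 0) ∨ ((-1 : ℤ) ^ m = -1 ∧ m % 2 = 1) := by
    rcases Nat.even_or_odd m with h | h
    · exact Or.inl ⟨h.neg_one_pow, Nat.even_iff.1 h⟩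
    · exact Or.inr ⟨h.neg_one_pow, Nat.odd_iff.1 h⟩
  have hT : T ((2 * m + 1) ^ 2) = {(-1) ^ m * ((2 * m + 1 : ℕ) : ℤ)} := by
    ext y
    rw [mem_T, Finset.mem_singleton]
    push_cast
    rw [sq_eq_sq_iff_eq_or_eq_neg]
    rcases hp with ⟨h, h'⟩ | ⟨h, h'⟩ <;> rw [h] <;> omega
  rw [g, hT, Finset.sum_singleton]

lemma g_one : g 1 = 1 := by
  simpa using g_sq 1 odd_one

lemma f_eq_g (n : ℕ) : f n = g n := by
  induction n using Nat.strong_induction_on with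
  | _ n ih =>
    rcases Nat.lt_or_ge n 2 with h | h
    · interval_cases n
      · rw [f_zero, g_zero]
      · rw [f_one, g_one]
    obtain ⟨m, rfl⟩ : ∃ m, n = m + 2 := ⟨n - 2, by omega⟩
    -- antisymmetric convolution
    have anti : ∑ p ∈ Finset.HasAntidiagonal.antidiagonal (m + 2 + 1), ((p.1 : ℤ) - p.2) * (g p.1 * g p.2) = 0 := by
      have h1 := Finset.Nat.sum_antidiagonal_swap (n := m + 2 + 1)
        (f := fun p : ℕ × ℕ => ((p.1 : ℤ) - p.2) * (g p.1 * g p.2))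
      have h2 : ∑ p ∈ Finset.HasAntidiagonal.antidiagonal (m + 2 + 1),
          (fun p : ℕ × ℕ => ((p.1 : ℤ) - p.2) * (g p.1 * g p.2)) p.swap =
          - ∑ p ∈ Finset.HasAntidiagonal.antidiagonal (m + 2 + 1), ((p.1 : ℤ) - p.2) * (g p.1 * g p.2) := by
        rw [← Finset.sum_neg_distrib]
        refine Finset.sum_congr rfl fun p _ => ?_
        simp only [Prod.fst_swap, Prod.snd_swap]; ring
      rw [h2] at h1
      omega
    have hc := conv_zero (m + 2 + 1)
    have hd : ∑ p ∈ Finset.HasAntidiagonal.antidiagonal (m + 2 + 1),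
        ((p.1 : ℤ) - p.2) * ((f p.1 - g p.1) * g p.2) = 0 := by
      have : ∀ p ∈ Finset.HasAntidiagonal.antidiagonal (m + 2 + 1),
        ((p.1 : ℤ) - p.2) * ((f p.1 - g p.1) * g p.2) =
        ((p.1 : ℤ) - p.2) * (f p.1 * g p.2) - ((p.1 : ℤ) - p.2) * (g p.1 * g p.2) := by
        intros; ring
      rw [Finset.sum_congr rfl this, Finset.sum_sub_distrib, hc, anti]; rfl
    rw [Finset.sum_eq_single (m + 2, 1)] at hd
    · simp only [g_one] at hd
      have h0 : (((m + 2 : ℕ) : ℤ) - (1 : ℕ)) ≠ 0 := by push_cast; omega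
      have := (mul_eq_zero.1 hd).resolve_left h0
      linarith
    · rintro ⟨a, b⟩ hab hne
      rw [Finset.HasAntidiagonal.mem_antidiagonal] at hab
      simp only at hab ⊢
      rcases Nat.eq_zero_or_pos b with rfl | hb
      · rw [g_zero]; ring
      · have : a < m + 2 := by
          have : b ≠ 1 := by rintro rfl; apply hne; simp; omega
          omega
        rw [ih a this]; ring
    · intro hn; simp at hn

/-! ### relation with the representation counts -/

/-- all solutions of `x² + y² + z² = n` -/
noncomputable def A (n : ℕ) : Finset (ℤ × ℤ × ℤ) :=
  (I n ×ˢ I n ×ˢ I n).filter fun t => t.1 ^ 2 + t.2.1 ^ 2 + t.2.2 ^ 2 = (n : ℤ)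

lemma mem_A {n : ℕ} {t : ℤ × ℤ × ℤ} :
    t ∈ A n ↔ t.1 ^ 2 + t.2.1 ^ 2 + t.2.2 ^ 2 = (n : ℤ) := by
  simp only [A, Finset.mem_filter, Finset.mem_product, and_iff_right_iff_imp]
  intro h
  refine ⟨mem_I ?_, mem_I ?_, mem_I ?_⟩ <;>
    nlinarith [sq_nonneg t.1, sq_nonneg t.2.1, sq_nonneg t.2.2]

lemma r_eq (n : ℕ) : r n = (A n).card := by
  rw [r, ← Set.ncard_coe_finset]
  congr 1
  ext t
  simp [mem_A]

lemma r'_eq (n : ℕ) : r' n =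
    ((A n).filter fun t => t.1 % 4 = 1 ∧ t.2.1 % 4 = 0 ∧ t.2.2 % 4 = 0).card := by
  rw [r', ← Set.ncard_coe_finset]
  congr 1
  ext t
  simp [mem_A]

lemma sq_mod8 (x : ℤ) : (x % 4 = 0 ∧ x ^ 2 % 8 = 0) ∨ (x % 4 = 1 ∧ x ^ 2 % 8 = 1) ∨
    (x % 4 = 2 ∧ x ^ 2 % 8 = 4) ∨ (x % 4 = 3 ∧ x ^ 2 % 8 = 1) := by
  have h : x % 8 = 0 ∨ x % 8 = 1 ∨ x % 8 = 2 ∨ x % 8 = 3 ∨ x % 8 = 4 ∨ x % 8 = 5 ∨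
    x % 8 = 6 ∨ x % 8 = 7 := by omega
  rcases h with h | h | h | h | h | h | h | h <;>
    [left; (right; left); (right; right; left); (right; right; right);
     left; (right; left); (right; right; left); (right; right; right)] <;>
    exact ⟨by omega, by rw [pow_two, Int.mul_emod, h]; rfl⟩

lemma perm_card (n : ℕ) (p q : ℤ × ℤ × ℤ → Prop) [DecidablePred p] [DecidablePred q]
    (e : ℤ × ℤ × ℤ → ℤ × ℤ × ℤ) (he : ∀ t, e (e t) = t)
    (hA : ∀ t, t ∈ A n → e t ∈ A n) (hpq : ∀ t, p t ↔ q (e t)) :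
    ((A n).filter p).card = ((A n).filter q).card := by
  refine Finset.card_nbij' e e ?_ ?_ (fun t _ => he t) (fun t _ => he t)
  · intro t
    simp only [Finset.coe_filter, Set.mem_ofPred_eq]
    rintro ⟨h1, h2⟩; exact ⟨hA t h1, (hpq t).1 h2⟩
  · intro t
    simp only [Finset.coe_filter, Set.mem_ofPred_eq]
    rintro ⟨h1, h2⟩; exact ⟨hA t h1, (hpq _).2 (by rwa [he])⟩

lemma card_A (n : ℕ) (hn : n % 8 = 1) :
    (A n).card = 6 * ((A n).filter fun t => t.1 % 4 = 1).card := by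
  have h1 : ((A n).filter fun t => t.1 % 4 = 3).card = ((A n).filter fun t => t.1 % 4 = 1).card :=
    perm_card n _ _ (fun t => (-t.1, t.2)) (by intro t; simp)
      (by intro t; simp [mem_A]) (by intro t; simp only; omega)
  have h2 : ((A n).filter fun t => t.2.1 % 4 = 1).card =
      ((A n).filter fun t => t.1 % 4 = 1).card :=
    perm_card n _ _ (fun t => (t.2.1, t.1, t.2.2)) (by intro t; simp)
      (by intro t; simp only [mem_A]; intro h; linarith) (by intro t; simp only)
  have h3 : ((A n).filter fun t => t.2.1 % 4 = 3).card =
      ((A n).filter fun t => t.1 % 4 = 3).card :=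
    perm_card n _ _ (fun t => (t.2.1, t.1, t.2.2)) (by intro t; simp)
      (by intro t; simp only [mem_A]; intro h; linarith) (by intro t; simp only)
  have h4 : ((A n).filter fun t => t.2.2 % 4 = 1).card =
      ((A n).filter fun t => t.1 % 4 = 1).card :=
    perm_card n _ _ (fun t => (t.2.2, t.2.1, t.1)) (by intro t; simp)
      (by intro t; simp only [mem_A]; intro h; linarith) (by intro t; simp only)
  have h5 : ((A n).filter fun t => t.2.2 % 4 = 3).card =
      ((A n).filter fun t => t.1 % 4 = 3).card :=
    perm_card n _ _ (fun t => (t.2.2, t.2.1, t.1)) (by intro t; simp)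
      (by intro t; simp only [mem_A]; intro h; linarith) (by intro t; simp only)
  have key : (A n).card = ((A n).filter fun t => t.1 % 4 = 1).card +
      ((A n).filter fun t => t.1 % 4 = 3).card + ((A n).filter fun t => t.2.1 % 4 = 1).card +
      ((A n).filter fun t => t.2.1 % 4 = 3).card + ((A n).filter fun t => t.2.2 % 4 = 1).card +
      ((A n).filter fun t => t.2.2 % 4 = 3).card := by
    simp only [Finset.card_filter, ← Finset.sum_add_distrib]
    rw [Finset.card_eq_sum_ones]
    refine Finset.sum_congr rfl fun t ht => ?_
    rw [mem_A] at ht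
    rcases sq_mod8 t.1 with ⟨a, a'⟩ | ⟨a, a'⟩ | ⟨a, a'⟩ | ⟨a, a'⟩ <;>
    rcases sq_mod8 t.2.1 with ⟨b, b'⟩ | ⟨b, b'⟩ | ⟨b, b'⟩ | ⟨b, b'⟩ <;>
    rcases sq_mod8 t.2.2 with ⟨c, c'⟩ | ⟨c, c'⟩ | ⟨c, c'⟩ | ⟨c, c'⟩ <;>
    first
    | (exfalso; omega)
    | simp [a, b, c]
  omega

lemma f_eq (n : ℕ) (hn : n % 8 = 1) :
    f n = 2 * (((A n).filter fun t => t.1 % 4 = 1 ∧ t.2.1 % 4 = 0 ∧ t.2.2 % 4 = 0).card : ℤ) -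
      ((A n).filter fun t => t.1 % 4 = 1).card := by
  have h : f n = ∑ t ∈ (A n).filter (fun t => t.1 % 4 = 1),
      (2 * (if t.2.1 % 4 = 0 ∧ t.2.2 % 4 = 0 then 1 else 0) - 1 : ℤ) := by
    rw [f]
    refine Finset.sum_nbij' (fun t => (t.1, 2 * (t.2.1 + t.2.2), 2 * (t.2.1 - t.2.2)))
      (fun t => (t.1, (t.2.1 + t.2.2) / 4, (t.2.1 - t.2.2) / 4)) ?_ ?_ ?_ ?_ ?_
    · intro t
      simp only [mem_S, mem_A, Finset.mem_filter]
      rintro ⟨h1, h2⟩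
      exact ⟨by linarith, h1⟩
    · intro t
      simp only [mem_S, mem_A, Finset.mem_filter]
      rintro ⟨h1, h2⟩
      refine ⟨h2, ?_⟩
      have hyz : (t.2.1 + t.2.2) % 4 = 0 ∧ (t.2.1 - t.2.2) % 4 = 0 := by
        rcases sq_mod8 t.1 with ⟨a, a'⟩ | ⟨a, a'⟩ | ⟨a, a'⟩ | ⟨a, a'⟩ <;>
        rcases sq_mod8 t.2.1 with ⟨b, b'⟩ | ⟨b, b'⟩ | ⟨b, b'⟩ | ⟨b, b'⟩ <;>
        rcases sq_mod8 t.2.2 with ⟨c, c'⟩ | ⟨c, c'⟩ | ⟨c, c'⟩ | ⟨c, c'⟩ <;>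
        omega
      obtain ⟨u, hu⟩ : ∃ u, u = (t.2.1 + t.2.2) / 4 := ⟨_, rfl⟩
      obtain ⟨v, hv⟩ : ∃ v, v = (t.2.1 - t.2.2) / 4 := ⟨_, rfl⟩
      rw [← hu, ← hv]
      have e1 : t.2.1 = 2 * (u + v) := by omega
      have e2 : t.2.2 = 2 * (u - v) := by omega
      rw [e1, e2] at h1
      linarith
    · rintro ⟨x, u, v⟩ _
      simp only [Prod.mk.injEq, true_and]
      omega
    · rintro ⟨x, y, z⟩
      simp only [mem_A, Finset.mem_filter, Prod.mk.injEq, true_and]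
      rintro ⟨h1, h2⟩
      rcases sq_mod8 x with ⟨a, a'⟩ | ⟨a, a'⟩ | ⟨a, a'⟩ | ⟨a, a'⟩ <;>
      rcases sq_mod8 y with ⟨b, b'⟩ | ⟨b, b'⟩ | ⟨b, b'⟩ | ⟨b, b'⟩ <;>
      rcases sq_mod8 z with ⟨c, c'⟩ | ⟨c, c'⟩ | ⟨c, c'⟩ | ⟨c, c'⟩ <;>
      omega
    · rintro ⟨x, u, v⟩ _
      simp only
      rcases sg_cases (u + v) with ⟨h, h'⟩ | ⟨h, h'⟩
      · rw [h, if_pos (by omega)]; norm_num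
      · rw [h, if_neg (by omega)]; norm_num
  rw [h, Finset.sum_sub_distrib, ← Finset.mul_sum, ← Finset.filter_filter]
  simp

end Stmt12

theorem stmt_12 (k : ℕ) (hk : 0 < k) (hodd : Odd k) :
    (12 * r' (k ^ 2) : ℤ) = (r (k ^ 2) : ℤ) + 6 * (-1) ^ ((k - 1) / 2) * k := by
  have hn : k ^ 2 % 8 = 1 := by
    have h : k % 8 = 1 ∨ k % 8 = 3 ∨ k % 8 = 5 ∨ k % 8 = 7 := by
      have := Nat.odd_iff.1 hodd
      omega
    rcases h with h | h | h | h <;> rw [pow_two, Nat.mul_mod, h]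
  have h1 := Stmt12.f_eq (k ^ 2) hn
  rw [Stmt12.f_eq_g, Stmt12.g_sq k hodd] at h1
  have h2 := Stmt12.card_A (k ^ 2) hn
  rw [Stmt12.r_eq, Stmt12.r'_eq, h2]
  push_cast
  linarith
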